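/- arXiv:2402.08544 — 2 statements merged into one kernel-verified Lean document; each statement's English description precedes it below -/
import Mathlib

section
/- Let C > 0, κ ∈ ℝ, t₁ > 0 and let a : (0,t₁] → (0,∞) be continuous with lim_{t→0⁺} a(t) = 0, satisfying ȧ(t) = √( (4π/3) C² a(t)^{−4} + (8π/3) a(t)^{−2} ρ(a(t)) − κ ) on (0,t₁] (with the expression under the square root positive). Then there exist constants 0 < c₁ ≤ c₂ and t' ∈ (0,t₁] such that c₁ t^{1/3} ≤ a(t) ≤ c₂ t^{1/3} for all t ∈ (0,t'] (i.e. a(t) ≃ t^{1/3} as t ↓ 0). -/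
open MeasureTheory Real Filter Topology Set

/-- FLRW Vlasov energy density:
`ρ(a) = 4π ∫₀^∞ R² √(m²a² + R²) 𝓕(R²) dR`. -/
noncomputable def vlasovRho (m : ℝ) (F : ℝ → ℝ) (a : ℝ) : ℝ :=
  4 * π * ∫ R in Ioi (0 : ℝ), R ^ 2 * Real.sqrt (m ^ 2 * a ^ 2 + R ^ 2) * F (R ^ 2)

theorem vlasovRho_nonneg' (m : ℝ) (F : ℝ → ℝ) (hFpos : ∀ x, 0 ≤ F x) (a : ℝ) :
    0 ≤ vlasovRho m F a := by
  unfold vlasovRho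
  have : 0 ≤ ∫ R in Ioi (0 : ℝ), R ^ 2 * Real.sqrt (m ^ 2 * a ^ 2 + R ^ 2) * F (R ^ 2) := by
    apply integral_nonneg
    intro R
    have := hFpos (R ^ 2)
    simp only [Pi.zero_apply]
    positivity
  positivity

theorem vlasovRho_bdd (m : ℝ) (hm : 0 ≤ m) (F : ℝ → ℝ)
    (hFcont : Continuous F) (hFsupp : HasCompactSupport F) (hFpos : ∀ x, 0 ≤ F x) :
    ∃ M : ℝ, ∀ a, 0 < a → a ≤ 1 → vlasovRho m F a ≤ M := by
  refine ⟨4 * π * ∫ R in Ioi (0 : ℝ), R ^ 2 * Real.sqrt (m ^ 2 + R ^ 2) * F (R ^ 2), ?_⟩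
  intro a ha ha1
  unfold vlasovRho
  apply mul_le_mul_of_nonneg_left _ (by positivity)
  apply integral_mono_of_nonneg
  · refine Eventually.of_forall fun R => ?_
    have := hFpos (R ^ 2)
    simp only [Pi.zero_apply]
    positivity
  · apply Integrable.integrableOn
    apply Continuous.integrable_of_hasCompactSupport
    · fun_prop
    · obtain ⟨r, hr⟩ := hFsupp.isCompact.isBounded.subset_closedBall (0 : ℝ)
      apply HasCompactSupport.intro (isCompact_Icc (a := -(|r| + 1)) (b := |r| + 1))
      intro x hx
      have : F (x ^ 2) = 0 := by
        by_contra h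
        have h1 := hr (subset_tsupport F h)
        rw [Metric.mem_closedBall, dist_zero_right, Real.norm_eq_abs, abs_of_nonneg (sq_nonneg x)] at h1
        apply hx
        rw [mem_Icc, ← abs_le]
        have h2 := le_abs_self r
        have h3 := abs_nonneg r
        have h4 := sq_abs x
        by_contra h5
        push Not at h5
        nlinarith
      simp [this]
  · refine Eventually.of_forall fun R => ?_
    have := hFpos (R ^ 2)
    have h2 : m ^ 2 * a ^ 2 ≤ m ^ 2 := by
      have : a ^ 2 ≤ 1 := by nlinarith
      nlinarith [sq_nonneg m]
    dsimp only
    gcongr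

/-- Big Bang asymptotics `a(t) ≃ t^{1/3}`: a continuous positive solution
of `ȧ = √((4π/3)C²a⁻⁴ + (8π/3)a⁻²ρ(a) − κ)` on `(0,t₁]` with `a(0⁺) = 0` satisfies
`c₁ t^{1/3} ≤ a(t) ≤ c₂ t^{1/3}` near `t = 0`. -/
theorem friedmann_scale_factor_asymptotics
    (m : ℝ) (hm : 0 ≤ m) (F : ℝ → ℝ)
    (hFcont : Continuous F) (hFsupp : HasCompactSupport F) (hFpos : ∀ x, 0 ≤ F x)
    (C : ℝ) (hC : 0 < C) (κ : ℝ) (t₁ : ℝ) (ht₁ : 0 < t₁)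
    (a : ℝ → ℝ)
    (hc : ContinuousOn a (Ioc (0 : ℝ) t₁))
    (hpos : ∀ t ∈ Ioc (0 : ℝ) t₁, 0 < a t)
    (hlim : Tendsto a (𝓝[>] (0 : ℝ)) (𝓝 0))
    (hsqrt : ∀ t ∈ Ioc (0 : ℝ) t₁,
      0 < 4 * π / 3 * C ^ 2 / (a t) ^ 4 + 8 * π / 3 * vlasovRho m F (a t) / (a t) ^ 2 - κ)
    (hderiv : ∀ t ∈ Ioc (0 : ℝ) t₁, HasDerivAt a
      (Real.sqrt (4 * π / 3 * C ^ 2 / (a t) ^ 4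
        + 8 * π / 3 * vlasovRho m F (a t) / (a t) ^ 2 - κ)) t) :
    ∃ c₁ c₂ t' : ℝ, 0 < c₁ ∧ c₁ ≤ c₂ ∧ 0 < t' ∧ t' ≤ t₁ ∧
      ∀ t ∈ Ioc (0 : ℝ) t',
        c₁ * t ^ ((1 : ℝ) / 3) ≤ a t ∧ a t ≤ c₂ * t ^ ((1 : ℝ) / 3) := by
  obtain ⟨M, hM⟩ := vlasovRho_bdd m hm F hFcont hFsupp hFpos
  set A : ℝ := 4 * π / 3 * C ^ 2 with hA
  have hApos : 0 < A := by positivity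
  set s := Real.sqrt A with hs
  have hspos : 0 < s := Real.sqrt_pos.2 hApos
  have hss : s ^ 2 = A := Real.sq_sqrt hApos.le
  set L : ℝ := 8 * π / 3 * |M| + |κ| with hL
  have hlim2 : Tendsto (fun t => L * a t ^ 2) (𝓝[>] (0 : ℝ)) (𝓝 0) := by
    have := (hlim.pow 2).const_mul L
    simpa using this
  have hlim3 : Tendsto (fun t => a t ^ 3) (𝓝[>] (0 : ℝ)) (𝓝 0) := by
    simpa using hlim.pow 3
  have hev : ∀ᶠ t in 𝓝[>] (0 : ℝ), L * a t ^ 2 < 3 / 4 * A ∧ a t < 1 :=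
    (hlim2.eventually_lt_const (by positivity)).and (hlim.eventually_lt_const one_pos)
  obtain ⟨u, hu, hsub⟩ := mem_nhdsGT_iff_exists_Ioc_subset.1 hev
  have hu0 : (0 : ℝ) < u := hu
  have hmin : 0 < min u t₁ := lt_min hu0 ht₁
  have hD : ∀ t ∈ Ioc (0 : ℝ) (min u t₁), ∃ d, HasDerivAt (fun t => a t ^ 3) d t ∧
      3 / 2 * s ≤ d ∧ d ≤ 6 * s := by
    intro t ht
    have ht1 : t ∈ Ioc (0 : ℝ) t₁ := ⟨ht.1, ht.2.trans (min_le_right _ _)⟩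
    obtain ⟨hb1, hb2⟩ := hsub (⟨ht.1, ht.2.trans (min_le_left _ _)⟩ : t ∈ Ioc (0 : ℝ) u)
    have hp := hpos t ht1
    have hq := hsqrt t ht1
    have hr0 := vlasovRho_nonneg' m F hFpos (a t)
    have hr1 := (hM (a t) hp hb2.le).trans (le_abs_self M)
    refine ⟨_, (hderiv t ht1).pow 3, ?_⟩
    set E := A / a t ^ 4 + 8 * π / 3 * vlasovRho m F (a t) / a t ^ 2 - κ with hE
    have hEa : E * a t ^ 4 = A + 8 * π / 3 * vlasovRho m F (a t) * a t ^ 2 - κ * a t ^ 4 := by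
      rw [hE]; field_simp
    have hk : |κ * a t ^ 4| ≤ |κ| * a t ^ 2 := by
      rw [abs_mul, abs_of_nonneg (by positivity : 0 ≤ a t ^ 4)]
      apply mul_le_mul_of_nonneg_left _ (abs_nonneg _)
      exact pow_le_pow_of_le_one hp.le hb2.le (by norm_num)
    have hk' := abs_le.1 hk
    have hρ1 : 8 * π / 3 * vlasovRho m F (a t) * a t ^ 2 ≤ 8 * π / 3 * |M| * a t ^ 2 := by
      gcongr
    have hρ0 : 0 ≤ 8 * π / 3 * vlasovRho m F (a t) * a t ^ 2 := by positivity
    have hM0 : 0 ≤ 8 * π / 3 * |M| * a t ^ 2 := by positivity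
    have hLe : L * a t ^ 2 = 8 * π / 3 * |M| * a t ^ 2 + |κ| * a t ^ 2 := by rw [hL]; ring
    have hsq : (Real.sqrt E * a t ^ 2) ^ 2 = E * a t ^ 4 := by
      rw [mul_pow, Real.sq_sqrt hq.le]; ring
    have hw : 0 ≤ Real.sqrt E * a t ^ 2 := by positivity
    have h1 : s / 2 ≤ Real.sqrt E * a t ^ 2 := by
      refine (sq_le_sq₀ (by positivity) hw).1 ?_
      rw [hsq, hEa, div_pow, hss]; linarith
    have h2 : Real.sqrt E * a t ^ 2 ≤ 2 * s := by
      refine (sq_le_sq₀ hw (by positivity)).1 ?_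
      rw [hsq, hEa, mul_pow, hss]; linarith
    norm_num
    constructor <;> nlinarith
  have hid : Tendsto (fun t : ℝ => t) (𝓝[>] (0 : ℝ)) (𝓝 0) := tendsto_nhdsWithin_of_tendsto_nhds tendsto_id
  have key : ∀ t ∈ Ioc (0 : ℝ) (min u t₁), 3 / 2 * s * t ≤ a t ^ 3 ∧ a t ^ 3 ≤ 6 * s * t := by
    intro t ht
    have hmv : ∀ᶠ e in 𝓝[>] (0 : ℝ), 3 / 2 * s * (t - e) ≤ a t ^ 3 - a e ^ 3 ∧
        a t ^ 3 - a e ^ 3 ≤ 6 * s * (t - e) := by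
      filter_upwards [Ioo_mem_nhdsGT ht.1] with e he
      have hm' : ∀ x ∈ Icc e t, x ∈ Ioc (0 : ℝ) (min u t₁) := fun x hx =>
        ⟨he.1.trans_le hx.1, hx.2.trans ht.2⟩
      have hcont : ContinuousOn (fun t => a t ^ 3) (Icc e t) := fun x hx => by
        obtain ⟨d, hd, _⟩ := hD x (hm' x hx)
        exact hd.continuousAt.continuousWithinAt
      have hdiff : DifferentiableOn ℝ (fun t => a t ^ 3) (interior (Icc e t)) := fun x hx => by
        obtain ⟨d, hd, _⟩ := hD x (hm' x (interior_subset hx))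
        exact hd.differentiableAt.differentiableWithinAt
      constructor
      · refine (convex_Icc e t).mul_sub_le_image_sub_of_le_deriv hcont hdiff (fun x hx => ?_)
          e (left_mem_Icc.2 he.2.le) t (right_mem_Icc.2 he.2.le) he.2.le
        obtain ⟨d, hd, h1, h2⟩ := hD x (hm' x (interior_subset hx))
        rw [hd.deriv]; exact h1
      · refine (convex_Icc e t).image_sub_le_mul_sub_of_deriv_le hcont hdiff (fun x hx => ?_)
          e (left_mem_Icc.2 he.2.le) t (right_mem_Icc.2 he.2.le) he.2.le
        obtain ⟨d, hd, h1, h2⟩ := hD x (hm' x (interior_subset hx))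
        rw [hd.deriv]; exact h2
    have l1 : Tendsto (fun e => a t ^ 3 - a e ^ 3) (𝓝[>] (0 : ℝ)) (𝓝 (a t ^ 3)) := by
      simpa using hlim3.const_sub (a t ^ 3)
    have l2 : ∀ k : ℝ, Tendsto (fun e => k * (t - e)) (𝓝[>] (0 : ℝ)) (𝓝 (k * t)) := fun k => by
      simpa using (hid.const_sub t).const_mul k
    exact ⟨le_of_tendsto_of_tendsto (l2 _) l1 (hmv.mono fun _ h => h.1),
      le_of_tendsto_of_tendsto l1 (l2 _) (hmv.mono fun _ h => h.2)⟩
  refine ⟨(3 / 2 * s) ^ ((1 : ℝ) / 3), (6 * s) ^ ((1 : ℝ) / 3), min u t₁, by positivity, ?_,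
    hmin, min_le_right _ _, ?_⟩
  · apply Real.rpow_le_rpow (by positivity) (by linarith) (by norm_num)
  · intro t ht
    have hp := hpos t ⟨ht.1, ht.2.trans (min_le_right _ _)⟩
    have ht0 := ht.1.le
    obtain ⟨h1, h2⟩ := key t ht
    have hcube : (a t ^ 3) ^ ((1 : ℝ) / 3) = a t := by
      rw [← Real.rpow_natCast, ← Real.rpow_mul hp.le]; norm_num
    rw [← Real.mul_rpow (by positivity) ht0, ← Real.mul_rpow (by positivity) ht0]
    constructor
    · have := Real.rpow_le_rpow (by positivity) h1 (by norm_num : (0 : ℝ) ≤ 1 / 3)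
      rwa [hcube] at this
    · have := Real.rpow_le_rpow (by positivity) h2 (by norm_num : (0 : ℝ) ≤ 1 / 3)
      rwa [hcube] at this
end

section
/- Let C > 0, κ > 0, and suppose a* > 0 satisfies κ = (4π/3) C² (a*)^{−4} + (8π/3) (a*)^{−2} ρ(a*). Then for every a with 0 < a ≤ a*, one has 12π C² a^{−4} + 12π a^{−2} ( ρ(a) + p(a) ) ≥ 3κ; equivalently, 12π C² a^{−4} − 3κ + 12π a^{−2} ( ρ(a) + p(a) ) ≥ 0. -/
open MeasureTheory Real Filter Topology Set

/-- FLRW Vlasov pressure: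
`p(a) = (4π/3) ∫₀^∞ R⁴ (m²a² + R²)^(−1/2) 𝓕(R²) dR`. -/
noncomputable def vlasovP (m : ℝ) (F : ℝ → ℝ) (a : ℝ) : ℝ :=
  4 * π / 3 * ∫ R in Ioi (0 : ℝ), R ^ 4 / Real.sqrt (m ^ 2 * a ^ 2 + R ^ 2) * F (R ^ 2)

theorem rho_integrable_aux (m : ℝ) (F : ℝ → ℝ) (hFcont : Continuous F)
    (hFsupp : HasCompactSupport F) (a : ℝ) :
    Integrable (fun R : ℝ => R ^ 2 * Real.sqrt (m ^ 2 * a ^ 2 + R ^ 2) * F (R ^ 2)) := by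
  apply Continuous.integrable_of_hasCompactSupport
  · fun_prop
  · obtain ⟨B, hB⟩ := (hFsupp.isCompact.isBounded).subset_closedBall (0 : ℝ)
    apply HasCompactSupport.intro (isCompact_closedBall (0 : ℝ) (|B| + 1))
    intro R hR
    have h0 : F (R ^ 2) = 0 := by
      apply image_eq_zero_of_notMem_tsupport
      intro h
      have h1 := hB h
      rw [Metric.mem_closedBall, dist_zero_right, Real.norm_eq_abs] at h1
      rw [Metric.mem_closedBall, dist_zero_right, Real.norm_eq_abs, not_le] at hR
      rw [abs_of_nonneg (sq_nonneg R), ← sq_abs] at h1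
      nlinarith [le_abs_self B, abs_nonneg B]
    simp [h0]

theorem sqrt_scale_aux (m a b R : ℝ) (ha : 0 < a) (hab : a ≤ b) :
    a ^ 2 * Real.sqrt (m ^ 2 * b ^ 2 + R ^ 2) ≤ b ^ 2 * Real.sqrt (m ^ 2 * a ^ 2 + R ^ 2) := by
  have hb : 0 < b := ha.trans_le hab
  have h : a * Real.sqrt (m ^ 2 * b ^ 2 + R ^ 2) ≤ b * Real.sqrt (m ^ 2 * a ^ 2 + R ^ 2) := by
    refine (pow_le_pow_iff_left₀ (by positivity) (by positivity) two_ne_zero).1 ?_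
    rw [mul_pow, mul_pow, Real.sq_sqrt (by positivity), Real.sq_sqrt (by positivity)]
    have : a ^ 2 ≤ b ^ 2 := by gcongr
    nlinarith [mul_le_mul_of_nonneg_right this (sq_nonneg R)]
  calc _ = a * (a * Real.sqrt (m ^ 2 * b ^ 2 + R ^ 2)) := by ring
    _ ≤ b * (b * Real.sqrt (m ^ 2 * a ^ 2 + R ^ 2)) := by gcongr
    _ = _ := by ring

/-- sign of the lapse-equation coefficient: if `κ > 0` and `a* > 0`
satisfies the turning-point relation `κ = (4π/3)C²(a*)⁻⁴ + (8π/3)(a*)⁻²ρ(a*)`, then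
for all `0 < a ≤ a*`,
`12πC²a⁻⁴ + 12πa⁻²(ρ(a) + p(a)) ≥ 3κ`. -/
theorem lapse_coefficient_nonneg
    (m : ℝ) (hm : 0 ≤ m) (F : ℝ → ℝ)
    (hFcont : Continuous F) (hFsupp : HasCompactSupport F) (hFpos : ∀ x, 0 ≤ F x)
    (C : ℝ) (hC : 0 < C) (κ : ℝ) (hκ : 0 < κ)
    (astar : ℝ) (hastar : 0 < astar)
    (hturn : κ = 4 * π / 3 * C ^ 2 / astar ^ 4
      + 8 * π / 3 * vlasovRho m F astar / astar ^ 2) :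
    ∀ a : ℝ, 0 < a → a ≤ astar →
      3 * κ ≤ 12 * π * C ^ 2 / a ^ 4
        + 12 * π * (vlasovRho m F a + vlasovP m F a) / a ^ 2 := by
  intro a ha hab
  have hrho : a ^ 2 * vlasovRho m F astar ≤ astar ^ 2 * vlasovRho m F a := by
    unfold vlasovRho
    have key : ∫ R in Ioi (0 : ℝ),
          a ^ 2 * (R ^ 2 * Real.sqrt (m ^ 2 * astar ^ 2 + R ^ 2) * F (R ^ 2))
        ≤ ∫ R in Ioi (0 : ℝ),
          astar ^ 2 * (R ^ 2 * Real.sqrt (m ^ 2 * a ^ 2 + R ^ 2) * F (R ^ 2)) := by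
      apply integral_mono
      · exact ((rho_integrable_aux m F hFcont hFsupp astar).const_mul _).integrableOn
      · exact ((rho_integrable_aux m F hFcont hFsupp a).const_mul _).integrableOn
      · intro R
        have h1 := mul_le_mul_of_nonneg_left (sqrt_scale_aux m a astar R ha hab)
          (mul_nonneg (sq_nonneg R) (hFpos (R ^ 2)))
        dsimp only
        linarith
    rw [integral_const_mul, integral_const_mul] at key
    have := mul_le_mul_of_nonneg_left key (by positivity : 0 ≤ 4 * π)
    linarith
  have hr0 : 0 ≤ vlasovRho m F a := by
    unfold vlasovRho
    refine mul_nonneg (by positivity) (integral_nonneg fun R => ?_)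
    exact mul_nonneg (by positivity) (hFpos _)
  have hp0 : 0 ≤ vlasovP m F a := by
    unfold vlasovP
    refine mul_nonneg (by positivity) (integral_nonneg fun R => ?_)
    exact mul_nonneg (by positivity) (hFpos _)
  have h1 : vlasovRho m F astar / astar ^ 2 ≤ vlasovRho m F a / a ^ 2 := by
    rw [div_le_div_iff₀ (by positivity) (by positivity)]
    linarith
  have h2 : C ^ 2 / astar ^ 4 ≤ C ^ 2 / a ^ 4 := by gcongr
  have h3 : 0 ≤ C ^ 2 / a ^ 4 := by positivity
  have h4 : 0 ≤ vlasovRho m F a / a ^ 2 := by positivity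
  have h5 : 0 ≤ vlasovP m F a / a ^ 2 := by positivity
  have h6 := Real.pi_pos
  calc 3 * κ = π * (4 * (C ^ 2 / astar ^ 4) + 8 * (vlasovRho m F astar / astar ^ 2)) := by
        rw [hturn]; ring
    _ ≤ π * (12 * (C ^ 2 / a ^ 4) + 12 * (vlasovRho m F a / a ^ 2 + vlasovP m F a / a ^ 2)) := by
        apply mul_le_mul_of_nonneg_left _ h6.le
        linarith
    _ = _ := by ring
end
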